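/- For every integer N ≥ 2, there is a bijection between the set of integers a ∈ {1,…,N−1} that are invertible modulo N and the set of finite sequences (α₁,…,α_l) of integers with l ≥ 1 and α_i ≥ 2 for all i such that det T(α₁,…,α_l) = N; the bijection sends a to the unique sequence (α₁,…,α_l) of integers ≥ 2 with M(α₁)⋯M(α_l) equal to the matrix with rows (−k,−b) and (a,N), where b ∈ {1,…,N−1} satisfies ab ≡ 1 (mod N) and k = (ab−1)/N. -/

import Mathlib

/-- The symmetric tridiagonal matrix with diagonal entries `α 0, …, α (n-1)` and
all sub- and superdiagonal entries equal to `1`. -/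
def Tmat {R : Type*} [CommRing R] {n : ℕ} (α : Fin n → R) : Matrix (Fin n) (Fin n) R :=
  Matrix.of fun i j =>
    if (i : ℕ) = (j : ℕ) then α i
    else if (i : ℕ) + 1 = (j : ℕ) ∨ (j : ℕ) + 1 = (i : ℕ) then 1 else 0

/-- The determinant of the tridiagonal matrix associated to a finite sequence. -/
def detT {R : Type*} [CommRing R] (L : List R) : R := (Tmat L.get).det

/-- The matrix `M(α) = !![0, -1; 1, α]`. -/
def Mmat (a : ℤ) : Matrix (Fin 2) (Fin 2) ℤ := !![0, -1; 1, a]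

theorem det_Tmat_succ_succ {R : Type*} [CommRing R] {n : ℕ} (α : Fin (n + 2) → R) :
    (Tmat α).det = α 0 * (Tmat (fun i : Fin (n + 1) => α i.succ)).det
      - (Tmat (fun i : Fin n => α i.succ.succ)).det := by
  have h0 : (Tmat α).submatrix Fin.succ (Fin.succAbove 0) =
      Tmat (fun i : Fin (n + 1) => α i.succ) := by
    ext i j
    simp [Tmat]
  have h1 : ((Tmat α).submatrix Fin.succ (Fin.succAbove (Fin.succ 0))).det =
      (Tmat (fun i : Fin n => α i.succ.succ)).det := by
    rw [Matrix.det_succ_column_zero, Fin.sum_univ_succ, Finset.sum_eq_zero]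
    · have h2 : ((Tmat α).submatrix Fin.succ (Fin.succAbove (Fin.succ 0))).submatrix
          (Fin.succAbove 0) Fin.succ = Tmat (fun i : Fin n => α i.succ.succ) := by
        ext i j
        simp [Tmat]
      rw [h2]
      simp [Tmat]
    · intro i _
      simp [Tmat]
  rw [Matrix.det_succ_row_zero, Fin.sum_univ_succ, Fin.sum_univ_succ, Finset.sum_eq_zero,
    h0, h1]
  · simp [Tmat]
    ring
  · intro i _
    simp [Tmat]

theorem detT_cons_cons {R : Type*} [CommRing R] (x y : R) (L : List R) :
    detT (x :: y :: L) = x * detT (y :: L) - detT L :=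
  det_Tmat_succ_succ (n := L.length) (x :: y :: L).get

theorem Mmat_mul_apply (x : ℤ) (P : Matrix (Fin 2) (Fin 2) ℤ) (j : Fin 2) :
    (Mmat x * P) 0 j = -P 1 j ∧ (Mmat x * P) 1 j = P 0 j + x * P 1 j := by
  simp [Mmat, Matrix.mul_apply, Fin.sum_univ_two]

theorem prod_Mmat_apply_one_one : ∀ L : List ℤ, (L.map Mmat).prod 1 1 = detT L
  | [] => by simp [detT]
  | [x] => by simp [detT, Mmat, Tmat]
  | x :: y :: L => by
    have h1 := prod_Mmat_apply_one_one (y :: L)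
    have h2 := prod_Mmat_apply_one_one L
    rw [detT_cons_cons, ← h1, ← h2, List.map_cons, List.prod_cons, (Mmat_mul_apply _ _ _).2,
      List.map_cons, List.prod_cons, (Mmat_mul_apply _ _ _).1]
    ring

theorem det_prod_Mmat (L : List ℤ) : (L.map Mmat).prod.det = 1 := by
  induction L with
  | nil => simp
  | cons x L ih =>
    rw [List.map_cons, List.prod_cons, Matrix.det_mul, ih]
    simp [Mmat, Matrix.det_fin_two]

theorem prod_Mmat_bounds (L : List ℤ) (hL : ∀ x ∈ L, 2 ≤ x) :
    (L.map Mmat).prod 0 0 ≤ 1 ∧ 1 ≤ (L.map Mmat).prod 1 0 + (L.map Mmat).prod 0 0 ∧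
    1 ≤ (L.map Mmat).prod 0 0 - (L.map Mmat).prod 0 1 ∧
    (L.map Mmat).prod 0 0 - (L.map Mmat).prod 0 1 ≤
      (L.map Mmat).prod 1 1 - (L.map Mmat).prod 1 0 := by
  induction L with
  | nil => simp
  | cons x L ih =>
    obtain ⟨h1, h2, h3, h4⟩ := ih fun y hy => hL y (List.mem_cons_of_mem _ hy)
    have hx : 2 ≤ x := hL x List.mem_cons_self
    simp only [List.map_cons, List.prod_cons, (Mmat_mul_apply _ _ _).1, (Mmat_mul_apply _ _ _).2]
    refine ⟨by linarith, ?_, by linarith, ?_⟩ <;> nlinarith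

theorem prod_Mmat_bounds_of_ne_nil (L : List ℤ) (hL : ∀ x ∈ L, 2 ≤ x) (hne : L ≠ []) :
    1 ≤ (L.map Mmat).prod 1 0 ∧ (L.map Mmat).prod 1 0 < (L.map Mmat).prod 1 1 ∧
    1 ≤ -(L.map Mmat).prod 0 1 ∧ -(L.map Mmat).prod 0 1 < (L.map Mmat).prod 1 1 := by
  obtain ⟨h1, h2, h3, h4⟩ := prod_Mmat_bounds L hL
  have h5 : (L.map Mmat).prod 0 0 ≤ 0 := by
    cases L with
    | nil => exact absurd rfl hne
    | cons x L =>
      obtain ⟨h1, h2, -, -⟩ := prod_Mmat_bounds L fun y hy => hL y (List.mem_cons_of_mem _ hy)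
      rw [List.map_cons, List.prod_cons, (Mmat_mul_apply _ _ _).1]
      linarith
  refine ⟨?_, ?_, ?_, ?_⟩ <;> linarith

theorem eq_of_prod_Mmat_column_eq (L L' : List ℤ) (hL : ∀ x ∈ L, 2 ≤ x) (hL' : ∀ x ∈ L', 2 ≤ x)
    (h0 : (L.map Mmat).prod 0 1 = (L'.map Mmat).prod 0 1)
    (h1 : (L.map Mmat).prod 1 1 = (L'.map Mmat).prod 1 1) : L = L' := by
  induction L generalizing L' with
  | nil =>
    cases L' with
    | nil => rfl
    | cons y L' =>
      have := (prod_Mmat_bounds_of_ne_nil _ hL' (List.cons_ne_nil _ _)).2.2.1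
      rw [← h0] at this
      simp at this
  | cons x L ih =>
    cases L' with
    | nil =>
      have := (prod_Mmat_bounds_of_ne_nil _ hL (List.cons_ne_nil _ _)).2.2.1
      rw [h0] at this
      simp at this
    | cons y L' =>
      have hl : ∀ z ∈ L, 2 ≤ z := fun z hz => hL z (List.mem_cons_of_mem _ hz)
      have hl' : ∀ z ∈ L', 2 ≤ z := fun z hz => hL' z (List.mem_cons_of_mem _ hz)
      obtain ⟨a1, a2, a3, a4⟩ := prod_Mmat_bounds L hl
      obtain ⟨b1, b2, b3, b4⟩ := prod_Mmat_bounds L' hl'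
      simp only [List.map_cons, List.prod_cons, (Mmat_mul_apply _ _ _).1,
        (Mmat_mul_apply _ _ _).2] at h0 h1
      have h2 : (L.map Mmat).prod 1 1 = (L'.map Mmat).prod 1 1 := by linarith
      rw [← h2] at h1
      have hxy : x = y := by
        apply le_antisymm <;> by_contra! hlt <;> nlinarith
      subst hxy
      rw [ih L' hl hl' (by linarith) h2]

theorem exists_prod_Mmat_column (n : ℕ) (b N : ℤ) (hn : b < n) (hb : 0 ≤ b) (hbN : b < N)
    (hco : IsCoprime b N) : ∃ L : List ℤ, (∀ x ∈ L, 2 ≤ x) ∧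
      (L.map Mmat).prod 0 1 = -b ∧ (L.map Mmat).prod 1 1 = N := by
  induction n generalizing b N with
  | zero => push_cast at hn; omega
  | succ n ih =>
    rcases hb.eq_or_lt with rfl | hb
    · rw [isCoprime_zero_left, Int.isUnit_iff] at hco
      exact ⟨[], by simp, by simp, by simp; omega⟩
    · have hdiv := Int.emod_add_mul_ediv (-N) b
      have hc0 := Int.emod_nonneg (-N) hb.ne'
      have hcb := Int.emod_lt_of_pos (-N) hb
      set c := -N % b
      set x := -(-N / b) with hx
      have hN : N = -c + x * b := by rw [hx]; linarith
      have hco' : IsCoprime c b := by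
        have h : IsCoprime b (-c + x * b) := hN ▸ hco
        exact ((IsCoprime.neg_right_iff b c).1 (IsCoprime.of_add_mul_right_right h)).symm
      obtain ⟨L, hL, h0, h1⟩ := ih c b (by push_cast at hn; omega) hc0 hcb hco'
      refine ⟨x :: L, ?_, ?_, ?_⟩
      · rintro y (_ | ⟨_, hy⟩)
        · by_contra! hlt
          nlinarith
        · exact hL y hy
      · rw [List.map_cons, List.prod_cons, (Mmat_mul_apply _ _ _).1, h1]
      · rw [List.map_cons, List.prod_cons, (Mmat_mul_apply _ _ _).2, h0, h1, hN]

theorem prod_Mmat_mul_sub (L : List ℤ) :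
    (L.map Mmat).prod 1 0 * -(L.map Mmat).prod 0 1 - 1 =
      -(L.map Mmat).prod 0 0 * (L.map Mmat).prod 1 1 := by
  have h := det_prod_Mmat L
  rw [Matrix.det_fin_two] at h
  linarith

theorem eq_of_mul_modEq_one {N a b c : ℤ} (hb : 1 ≤ b) (hbN : b < N) (hc : 1 ≤ c) (hcN : c < N)
    (hab : a * b ≡ 1 [ZMOD N]) (hac : a * c ≡ 1 [ZMOD N]) : b = c := by
  have h : b ≡ c [ZMOD N] := by
    calc b = b * 1 := (mul_one b).symm
      _ ≡ b * (a * c) [ZMOD N] := hac.symm.mul_left b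
      _ = a * b * c := by ring
      _ ≡ 1 * c [ZMOD N] := hab.mul_right c
      _ = c := one_mul c
  rwa [Int.ModEq, Int.emod_eq_of_lt (by omega) hbN, Int.emod_eq_of_lt (by omega) hcN] at h

theorem prod_Mmat_mul_modEq_one (L : List ℤ) :
    (L.map Mmat).prod 1 0 * -(L.map Mmat).prod 0 1 ≡ 1 [ZMOD detT L] := by
  refine (Int.modEq_iff_dvd.2 ⟨-(L.map Mmat).prod 0 0, ?_⟩).symm
  rw [prod_Mmat_mul_sub, prod_Mmat_apply_one_one, mul_comm]

theorem stmt9 (N : ℤ) (hN : 2 ≤ N) :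
    ∃ f : {a : ℤ // 1 ≤ a ∧ a ≤ N - 1 ∧ IsCoprime a N} →
        {L : List ℤ // L ≠ [] ∧ (∀ x ∈ L, 2 ≤ x) ∧ detT L = N},
      Function.Bijective f ∧
      ∀ a : {a : ℤ // 1 ≤ a ∧ a ≤ N - 1 ∧ IsCoprime a N}, ∀ b : ℤ,
        1 ≤ b → b ≤ N - 1 → a.1 * b ≡ 1 [ZMOD N] →
        (((f a : List ℤ)).map Mmat).prod = !![-((a.1 * b - 1) / N), -b; a.1, N] := by
  let g : {L : List ℤ // L ≠ [] ∧ (∀ x ∈ L, 2 ≤ x) ∧ detT L = N} →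
      {a : ℤ // 1 ≤ a ∧ a ≤ N - 1 ∧ IsCoprime a N} := fun L =>
    ⟨(L.1.map Mmat).prod 1 0, by
      obtain ⟨L, hne, hL, hdet⟩ := L
      obtain ⟨h1, h2, -, -⟩ := prod_Mmat_bounds_of_ne_nil L hL hne
      have hs := prod_Mmat_mul_sub L
      rw [prod_Mmat_apply_one_one, hdet] at h2 hs
      exact ⟨h1, Int.le_sub_one_of_lt h2, -(L.map Mmat).prod 0 1, (L.map Mmat).prod 0 0, by linarith⟩⟩
  have hg : Function.Bijective g := by
    constructor
    · rintro ⟨L, hne, hL, hdet⟩ ⟨L', hne', hL', hdet'⟩ h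
      have h10 : (L.map Mmat).prod 1 0 = (L'.map Mmat).prod 1 0 := congrArg Subtype.val h
      obtain ⟨-, -, h3, h4⟩ := prod_Mmat_bounds_of_ne_nil L hL hne
      obtain ⟨-, -, h3', h4'⟩ := prod_Mmat_bounds_of_ne_nil L' hL' hne'
      have hm := prod_Mmat_mul_modEq_one L
      have hm' := prod_Mmat_mul_modEq_one L'
      rw [prod_Mmat_apply_one_one, hdet] at h4
      rw [prod_Mmat_apply_one_one, hdet'] at h4'
      rw [hdet, h10] at hm
      rw [hdet'] at hm'
      have hb := eq_of_mul_modEq_one h3 h4 h3' h4' hm hm'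
      refine Subtype.ext (eq_of_prod_Mmat_column_eq L L' hL hL' (neg_injective hb) ?_)
      rw [prod_Mmat_apply_one_one, prod_Mmat_apply_one_one, hdet, hdet']
    · rintro ⟨a, ha1, haN, u, v, huv⟩
      have hmod : a * (u % N) ≡ 1 [ZMOD N] :=
        ((Int.mod_modEq u N).mul_left a).trans
          (Int.modEq_iff_dvd.2 ⟨v, by linarith⟩)
      obtain ⟨w, hw⟩ := Int.modEq_iff_dvd.1 hmod
      have hlt := Int.emod_lt_of_pos u (by omega : 0 < N)
      obtain ⟨L, hL, h0, h1⟩ := exists_prod_Mmat_column ((u % N).toNat + 1) (u % N) N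
        (by omega) (Int.emod_nonneg u (by omega)) hlt ⟨a, w, by linarith⟩
      have hne : L ≠ [] := by
        rintro rfl
        simp at h1
        omega
      have hdet : detT L = N := by rw [← prod_Mmat_apply_one_one, h1]
      refine ⟨⟨L, hne, hL, hdet⟩, Subtype.ext ?_⟩
      obtain ⟨h2, h3, -, -⟩ := prod_Mmat_bounds_of_ne_nil L hL hne
      have hm := prod_Mmat_mul_modEq_one L
      rw [hdet, h0, neg_neg, mul_comm] at hm
      rw [h1] at h3
      exact eq_of_mul_modEq_one h2 h3 ha1 (Int.lt_of_le_sub_one haN) hm (by rwa [mul_comm])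
  refine ⟨(Equiv.ofBijective g hg).symm, Equiv.bijective _, fun a b hb hbN hab => ?_⟩
  obtain ⟨L, rfl⟩ := (Equiv.ofBijective g hg).surjective a
  rw [Equiv.symm_apply_apply]
  obtain ⟨L, hne, hL, hdet⟩ := L
  change (L.map Mmat).prod 1 0 * b ≡ 1 [ZMOD N] at hab
  change (L.map Mmat).prod = !![-(((L.map Mmat).prod 1 0 * b - 1) / N), -b;
    (L.map Mmat).prod 1 0, N]
  obtain ⟨-, -, h3, h4⟩ := prod_Mmat_bounds_of_ne_nil L hL hne
  have hm := prod_Mmat_mul_modEq_one L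
  have h11 := prod_Mmat_apply_one_one L
  rw [hdet] at hm h11
  rw [h11] at h4
  obtain rfl := eq_of_mul_modEq_one hb (by omega) h3 h4 hab hm
  rw [prod_Mmat_mul_sub, h11, Int.mul_ediv_cancel _ (by omega), neg_neg, neg_neg]
  conv_lhs => rw [Matrix.eta_fin_two (L.map Mmat).prod, h11]
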